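/- arXiv:0704.3110 — 2 statements merged into one kernel-verified Lean document; each statement's English description precedes it below -/
import Mathlib

section
/- Let P : [0,∞) → ℝ be C¹, h C¹ on (0,∞) with h'(r) = P'(r)/r, and let (ρ, u) be a classical solution of the 1D QHD system on [0,1]×[0,T]. Define K(x,t) = ½u² + h(ρ) − (√ρ)_xx/√ρ. If the map t ↦ ∫₀¹ u(x,t) dx is constant on [0,T], then K(0,t) = K(1,t) for every t ∈ (0,T). -/
open MeasureTheory Real Set

/-- Partial derivative in the first (space) variable. -/
noncomputable def pdx (f : ℝ → ℝ → ℝ) (x t : ℝ) : ℝ := deriv (fun y => f y t) x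

/-- Partial derivative in the second (time) variable. -/
noncomputable def pdt (f : ℝ → ℝ → ℝ) (x t : ℝ) : ℝ := deriv (fun s => f x s) t

/-- Pointwise square root of a function of `(x, t)`. -/
noncomputable def sqf (ρ : ℝ → ℝ → ℝ) (x t : ℝ) : ℝ := Real.sqrt (ρ x t)

/-- A classical solution of the one-dimensional quantum hydrodynamic system (with ε² = 2)
`ρ_t + (ρu)_x = 0`, `(ρu)_t + (ρu² + P(ρ))_x = ρ·((√ρ)_xx/√ρ)_x` on `[0,1] × [0,T]`:
`ρ > 0`, `ρ` of class `C¹` in `t` and `C³` in `x`, `u` of class `C¹` in `t` and `C²` in `x`,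
all derivatives jointly continuous, and both equations hold pointwise. -/
structure IsQHDSolution1D (P : ℝ → ℝ) (ρ u : ℝ → ℝ → ℝ) (T : ℝ) : Prop where
  pos : ∀ x ∈ Set.Icc (0:ℝ) 1, ∀ t ∈ Set.Icc (0:ℝ) T, 0 < ρ x t
  rho_C3_x : ∀ t ∈ Set.Icc (0:ℝ) T, ContDiff ℝ 3 (fun x => ρ x t)
  rho_C1_t : ∀ x ∈ Set.Icc (0:ℝ) 1, ContDiff ℝ 1 (fun t => ρ x t)
  u_C2_x : ∀ t ∈ Set.Icc (0:ℝ) T, ContDiff ℝ 2 (fun x => u x t)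
  u_C1_t : ∀ x ∈ Set.Icc (0:ℝ) 1, ContDiff ℝ 1 (fun t => u x t)
  rho_cont : Continuous fun p : ℝ × ℝ => ρ p.1 p.2
  u_cont : Continuous fun p : ℝ × ℝ => u p.1 p.2
  rho_t_cont : Continuous fun p : ℝ × ℝ => pdt ρ p.1 p.2
  rho_x_cont : Continuous fun p : ℝ × ℝ => pdx ρ p.1 p.2
  rho_xx_cont : Continuous fun p : ℝ × ℝ => pdx (pdx ρ) p.1 p.2
  rho_xxx_cont : Continuous fun p : ℝ × ℝ => pdx (pdx (pdx ρ)) p.1 p.2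
  u_t_cont : Continuous fun p : ℝ × ℝ => pdt u p.1 p.2
  u_x_cont : Continuous fun p : ℝ × ℝ => pdx u p.1 p.2
  u_xx_cont : Continuous fun p : ℝ × ℝ => pdx (pdx u) p.1 p.2
  mass : ∀ x ∈ Set.Icc (0:ℝ) 1, ∀ t ∈ Set.Icc (0:ℝ) T,
    pdt ρ x t + pdx (fun y s => ρ y s * u y s) x t = 0
  momentum : ∀ x ∈ Set.Icc (0:ℝ) 1, ∀ t ∈ Set.Icc (0:ℝ) T,
    pdt (fun y s => ρ y s * u y s) x t
      + pdx (fun y s => ρ y s * u y s ^ 2 + P (ρ y s)) x t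
      = ρ x t * pdx (fun y s => pdx (pdx (sqf ρ)) y s / sqf ρ y s) x t

/-- Differentiating `∫ₐᵇ f(x, t) dx` under the integral sign when `∂ₜf` is jointly continuous. -/
theorem hasDerivAt_intervalIntegral_pdt {f : ℝ → ℝ → ℝ} {a b : ℝ}
    (hf : ∀ x ∈ Set.uIcc a b, Differentiable ℝ (f x))
    (hfc : Continuous fun p : ℝ × ℝ => f p.1 p.2)
    (hft : Continuous fun p : ℝ × ℝ => pdt f p.1 p.2) (t : ℝ) :
    HasDerivAt (fun s => ∫ x in a..b, f x s) (∫ x in a..b, pdt f x t) t := by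
  obtain ⟨C, hC⟩ := (isCompact_uIcc.prod (isCompact_Icc (a := t - 1) (b := t + 1))
    ).exists_bound_of_continuousOn (s := Set.uIcc a b ×ˢ Set.Icc (t - 1) (t + 1)) hft.continuousOn
  have hslice (s : ℝ) : Continuous fun x => f x s :=
    hfc.comp (continuous_id.prodMk continuous_const)
  have hslice' : Continuous fun x => pdt f x t :=
    hft.comp (continuous_id.prodMk continuous_const)
  refine (intervalIntegral.hasDerivAt_integral_of_dominated_loc_of_deriv_le
    (F := fun s x => f x s) (F' := fun s x => pdt f x s) (bound := fun _ => C)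
    (Icc_mem_nhds (sub_one_lt t) (lt_add_one t))
    (.of_forall fun s => (hslice s).aestronglyMeasurable) ((hslice t).intervalIntegrable _ _)
    hslice'.aestronglyMeasurable (.of_forall fun x hx s hs => ?_)
    intervalIntegrable_const (.of_forall fun x hx s _ => ?_)).2
  · exact hC (x, s) ⟨Set.uIoc_subset_uIcc hx, hs⟩
  · exact (hf x (Set.uIoc_subset_uIcc hx) s).hasDerivAt

/-- The quantum potential `(√f)_xx / √f` of a positive `C³` function is differentiable. -/
theorem differentiableAt_deriv_deriv_sqrt_div {f : ℝ → ℝ} {x : ℝ} (hf : ContDiffAt ℝ 3 f x)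
    (hx : 0 < f x) :
    DifferentiableAt ℝ (fun y => deriv (deriv fun z => √(f z)) y / √(f y)) x := by
  have hs : ContDiffAt ℝ 3 (fun z => √(f z)) x := hf.sqrt hx.ne'
  have h1 : ContDiffAt ℝ 2 (deriv fun z => √(f z)) x := hs.derivWithin (by norm_num)
  have h2 : ContDiffAt ℝ 1 (deriv (deriv fun z => √(f z))) x := h1.derivWithin (by norm_num)
  exact (h2.differentiableAt (by norm_num)).div (hs.differentiableAt (by norm_num))
    (Real.sqrt_ne_zero'.2 hx)

namespace IsQHDSolution1D

variable {P h : ℝ → ℝ} {ρ u : ℝ → ℝ → ℝ} {T x t : ℝ}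

/-- The momentum equation in Bernoulli form: `∂ₓ(½u² + h(ρ) − (√ρ)_xx/√ρ) = −uₜ`. -/
theorem hasDerivAt_isoEnergy (hsol : IsQHDSolution1D P ρ u T)
    (hP : ContDiffOn ℝ 1 P (Set.Ici 0)) (hh : ContDiffOn ℝ 1 h (Set.Ioi 0))
    (hh' : ∀ r > (0:ℝ), deriv h r = deriv P r / r)
    (hx : x ∈ Set.Icc (0:ℝ) 1) (ht : t ∈ Set.Icc (0:ℝ) T) :
    HasDerivAt (fun y => u y t ^ 2 / 2 + h (ρ y t) - pdx (pdx (sqf ρ)) y t / sqf ρ y t)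
      (-pdt u x t) x := by
  have hpos := hsol.pos x hx t ht
  have hρx : HasDerivAt (fun y => ρ y t) (pdx ρ x t) x :=
    ((hsol.rho_C3_x t ht).differentiable (by norm_num) x).hasDerivAt
  have hux : HasDerivAt (fun y => u y t) (pdx u x t) x :=
    ((hsol.u_C2_x t ht).differentiable (by norm_num) x).hasDerivAt
  have hρt : HasDerivAt (fun s => ρ x s) (pdt ρ x t) t :=
    ((hsol.rho_C1_t x hx).differentiable (by norm_num) t).hasDerivAt
  have hut : HasDerivAt (fun s => u x s) (pdt u x t) t :=
    ((hsol.u_C1_t x hx).differentiable (by norm_num) t).hasDerivAt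
  have hPd : HasDerivAt P (deriv P (ρ x t)) (ρ x t) :=
    ((hP.contDiffAt (Ici_mem_nhds hpos)).differentiableAt (by norm_num)).hasDerivAt
  have hhd : HasDerivAt h (deriv P (ρ x t) / ρ x t) (ρ x t) := by
    rw [← hh' _ hpos]
    exact ((hh.contDiffAt (Ioi_mem_nhds hpos)).differentiableAt (by norm_num)).hasDerivAt
  have hq : HasDerivAt (fun y => pdx (pdx (sqf ρ)) y t / sqf ρ y t)
      (pdx (fun y s => pdx (pdx (sqf ρ)) y s / sqf ρ y s) x t) x :=
    (differentiableAt_deriv_deriv_sqrt_div (hsol.rho_C3_x t ht).contDiffAt hpos).hasDerivAt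
  have hmass := hsol.mass x hx t ht
  have hmom := hsol.momentum x hx t ht
  have e1 : pdx (fun y s => ρ y s * u y s) x t = _ := (hρx.mul hux).deriv
  have e2 : pdt (fun y s => ρ y s * u y s) x t = _ := (hρt.mul hut).deriv
  have e3 : pdx (fun y s => ρ y s * u y s ^ 2 + P (ρ y s)) x t = _ :=
    ((hρx.mul (hux.pow 2)).add (hPd.comp x hρx)).deriv
  rw [e1] at hmass
  rw [e2, e3] at hmom
  refine ((((hux.pow 2).div_const 2).add (hhd.comp x hρx)).sub hq).congr_deriv ?_
  apply mul_left_cancel₀ hpos.ne'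
  norm_num [Pi.pow_apply] at hmom
  field_simp
  linear_combination 2 * hmom - 2 * u x t * hmass

end IsQHDSolution1D

/-- If the total velocity `∫₀¹ u(x,t) dx` is constant in time for a classical solution of the
1D QHD system, then the iso-energy functional `K = ½u² + h(ρ) − (√ρ)_xx/√ρ` takes the same
value at the two endpoints: `K(0,t) = K(1,t)`. -/
theorem qhd1d_iso_energy_boundary
    (P h : ℝ → ℝ) (hP : ContDiffOn ℝ 1 P (Set.Ici 0))
    (hh : ContDiffOn ℝ 1 h (Set.Ioi 0))
    (hh' : ∀ r > (0:ℝ), deriv h r = deriv P r / r)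
    (T : ℝ) (hT : 0 ≤ T) (ρ u : ℝ → ℝ → ℝ)
    (hsol : IsQHDSolution1D P ρ u T)
    (K : ℝ → ℝ → ℝ)
    (hK : ∀ x t : ℝ, K x t = u x t ^ 2 / 2 + h (ρ x t) - pdx (pdx (sqf ρ)) x t / sqf ρ x t)
    (hconst : ∀ t ∈ Set.Icc (0:ℝ) T, (∫ x in (0:ℝ)..1, u x t) = ∫ x in (0:ℝ)..1, u x 0) :
    ∀ t ∈ Set.Ioo (0:ℝ) T, K 0 t = K 1 t := by
  intro t ht
  have ht' := Set.Ioo_subset_Icc_self ht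
  have huIcc : Set.uIcc (0:ℝ) 1 = Set.Icc 0 1 := Set.uIcc_of_le zero_le_one
  have hderiv : HasDerivAt (fun s => ∫ x in (0:ℝ)..1, u x s) (∫ x in (0:ℝ)..1, pdt u x t) t :=
    hasDerivAt_intervalIntegral_pdt
      (fun x hx => (hsol.u_C1_t x (huIcc ▸ hx)).differentiable one_ne_zero)
      hsol.u_cont hsol.u_t_cont t
  have hzero : HasDerivAt (fun s => ∫ x in (0:ℝ)..1, u x s) 0 t := by
    refine (hasDerivAt_const t (∫ x in (0:ℝ)..1, u x 0)).congr_of_eventuallyEq ?_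
    filter_upwards [Icc_mem_nhds ht.1 ht.2] with s hs using hconst s hs
  have hcont : Continuous fun x => -pdt u x t :=
    (hsol.u_t_cont.comp (continuous_id.prodMk continuous_const)).neg
  have hftc : ∫ x in (0:ℝ)..1, -pdt u x t = K 1 t - K 0 t := by
    simp only [hK]
    exact intervalIntegral.integral_eq_sub_of_hasDerivAt
      (fun x hx => hsol.hasDerivAt_isoEnergy hP hh hh' (huIcc ▸ hx) ht')
      (hcont.intervalIntegrable _ _)
  rw [intervalIntegral.integral_neg, hderiv.unique hzero] at hftc
  linarith
end

section
/- Let P : [0,∞) → ℝ be C¹, h C¹ on (0,∞) with h'(r) = P'(r)/r, and assume P(r)/r ≤ h(r) for all r > 0. Let (ρ, u) be a classical solution of the 1D QHD system on [0,1]×[0,T] with initial data ρ(·,0) = ρ_I, u(·,0) = u_I, satisfying ρ_x(0,t) = ρ_x(1,t) = 0 for all t ∈ [0,T]. Set I(t) := ∫₀¹ x(1−x) ρ(x,t) dx, M₀ := ∫₀¹ (1−2x) ρ_I u_I dx, and K(x,t) = ½u² + h(ρ) − (√ρ)_xx/√ρ. Then for every t ∈ [0,T]: I'(t) ≤ M₀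 − 2 ∫₀ᵗ ∫₀¹ (ρu² + P(ρ) + 2((√ρ)_x)²) dx ds + ∫₀ᵗ ρ(1,s)·(K(1,s) + ½u(1,s)²) ds + ∫₀ᵗ ρ(0,s)·(K(0,s) + ½u(0,s)²) ds. -/
open MeasureTheory Real Set

/-- Differentiation under the integral sign over `[0,1]` for jointly continuous integrands. -/
theorem hasDerivAt_integral_of_continuous {f f' : ℝ → ℝ → ℝ}
    (hf : Continuous fun p : ℝ × ℝ => f p.1 p.2)
    (hf' : Continuous fun p : ℝ × ℝ => f' p.1 p.2)
    (hd : ∀ x ∈ Set.Icc (0:ℝ) 1, ∀ t, HasDerivAt (fun s => f x s) (f' x t) t) (t : ℝ) :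
    HasDerivAt (fun s => ∫ x in (0:ℝ)..1, f x s) (∫ x in (0:ℝ)..1, f' x t) t := by
  have hsub : Set.uIoc (0:ℝ) 1 ⊆ Set.Icc 0 1 := by
    rw [Set.uIoc_of_le zero_le_one]; exact Set.Ioc_subset_Icc_self
  obtain ⟨C, hC⟩ := (isCompact_Icc.prod (isCompact_closedBall t 1)).exists_bound_of_continuousOn
    (s := Set.Icc (0:ℝ) 1 ×ˢ Metric.closedBall t 1) hf'.continuousOn
  have hfx : ∀ s, Continuous fun x => f x s := fun s => by fun_prop
  have hfx' : ∀ s, Continuous fun x => f' x s := fun s => by fun_prop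
  refine (intervalIntegral.hasDerivAt_integral_of_dominated_loc_of_deriv_le
    (F := fun s x => f x s) (F' := fun s x => f' x s) (bound := fun _ => C)
    (Metric.ball_mem_nhds t one_pos) ?_ ?_ ?_ ?_ ?_ ?_).2
  · exact Filter.Eventually.of_forall fun s => (hfx s).aestronglyMeasurable
  · exact (hfx t).intervalIntegrable _ _
  · exact (hfx' t).aestronglyMeasurable
  · exact Filter.Eventually.of_forall fun x hx s hs =>
      hC (x, s) ⟨hsub hx, Metric.ball_subset_closedBall hs⟩
  · exact intervalIntegrable_const
  · exact Filter.Eventually.of_forall fun x hx s _ => hd x (hsub hx) s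

theorem ContDiff.hasDerivAt_deriv_of_succ {n : ℕ} {f : ℝ → ℝ} (hf : ContDiff ℝ (n + 1) f) :
    (∀ x, HasDerivAt f (deriv f x) x) ∧ ContDiff ℝ n (deriv f) := by
  obtain ⟨h1, -, h2⟩ := contDiff_succ_iff_deriv.1 hf
  exact ⟨fun x => (h1 x).hasDerivAt, h2⟩

namespace IsQHDSolution1D

variable {P : ℝ → ℝ} {ρ u : ℝ → ℝ → ℝ} {T : ℝ}

theorem hasDerivAt_rho (hs : IsQHDSolution1D P ρ u T) {t : ℝ} (ht : t ∈ Set.Icc 0 T) (x : ℝ) :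
    HasDerivAt (fun y => ρ y t) (pdx ρ x t) x ∧
    HasDerivAt (fun y => pdx ρ y t) (pdx (pdx ρ) x t) x ∧
    HasDerivAt (fun y => pdx (pdx ρ) y t) (pdx (pdx (pdx ρ)) x t) x := by
  obtain ⟨h1, h1'⟩ := ContDiff.hasDerivAt_deriv_of_succ (n := 2)
    ((hs.rho_C3_x t ht).of_le (by norm_num))
  obtain ⟨h2, h2'⟩ := ContDiff.hasDerivAt_deriv_of_succ (n := 1) (h1'.of_le (by norm_num))
  obtain ⟨h3, -⟩ := ContDiff.hasDerivAt_deriv_of_succ (n := 0) (h2'.of_le (by norm_num))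
  exact ⟨h1 x, h2 x, h3 x⟩

theorem hasDerivAt_u (hs : IsQHDSolution1D P ρ u T) {t : ℝ} (ht : t ∈ Set.Icc 0 T) (x : ℝ) :
    HasDerivAt (fun y => u y t) (pdx u x t) x :=
  ((hs.u_C2_x t ht).differentiable (by norm_num) x).hasDerivAt

theorem hasDerivAt_rho_time (hs : IsQHDSolution1D P ρ u T) {x : ℝ} (hx : x ∈ Set.Icc (0:ℝ) 1)
    (t : ℝ) : HasDerivAt (fun s => ρ x s) (pdt ρ x t) t :=
  ((hs.rho_C1_t x hx).differentiable (by norm_num) t).hasDerivAt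

theorem hasDerivAt_u_time (hs : IsQHDSolution1D P ρ u T) {x : ℝ} (hx : x ∈ Set.Icc (0:ℝ) 1)
    (t : ℝ) : HasDerivAt (fun s => u x s) (pdt u x t) t :=
  ((hs.u_C1_t x hx).differentiable (by norm_num) t).hasDerivAt

theorem eventually_pos (hs : IsQHDSolution1D P ρ u T) {x t : ℝ} (hx : 0 < ρ x t) :
    ∀ᶠ y in nhds x, 0 < ρ y t := by
  have hc : Continuous fun y => ρ y t := hs.rho_cont.comp (by fun_prop : Continuous fun y => (y, t))
  exact hc.continuousAt.eventually (lt_mem_nhds hx)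

theorem pdx_sqf (hs : IsQHDSolution1D P ρ u T) {x t : ℝ} (ht : t ∈ Set.Icc 0 T)
    (hx : 0 < ρ x t) : pdx (sqf ρ) x t = pdx ρ x t / (2 * √(ρ x t)) :=
  ((hs.hasDerivAt_rho ht x).1.sqrt hx.ne').deriv

theorem pdx_sqf_sq (hs : IsQHDSolution1D P ρ u T) {x t : ℝ} (ht : t ∈ Set.Icc 0 T)
    (hx : 0 < ρ x t) : pdx (sqf ρ) x t ^ 2 = pdx ρ x t ^ 2 / (4 * ρ x t) := by
  rw [hs.pdx_sqf ht hx, div_pow, mul_pow, Real.sq_sqrt hx.le]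
  norm_num

/-- The Bohm potential in terms of the derivatives of the density. -/
theorem bohm_eq (hs : IsQHDSolution1D P ρ u T) {x t : ℝ} (ht : t ∈ Set.Icc 0 T)
    (hx : 0 < ρ x t) :
    pdx (pdx (sqf ρ)) x t / sqf ρ x t
      = pdx (pdx ρ) x t / (2 * ρ x t) - pdx ρ x t ^ 2 / (4 * ρ x t ^ 2) := by
  obtain ⟨h1, h2, -⟩ := hs.hasDerivAt_rho ht x
  have hpos : 0 < √(ρ x t) := Real.sqrt_pos.2 hx
  have hev : (fun y => pdx (sqf ρ) y t) =ᶠ[nhds x] fun y => pdx ρ y t / (2 * √(ρ y t)) := by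
    filter_upwards [hs.eventually_pos hx] with y hy using hs.pdx_sqf ht hy
  have hd := h2.div ((h1.sqrt hx.ne').const_mul 2) (by positivity)
  have he : pdx (pdx (sqf ρ)) x t = _ := hev.deriv_eq.trans hd.deriv
  rw [he]
  have hsq : ρ x t = √(ρ x t) ^ 2 := (Real.sq_sqrt hx.le).symm
  unfold sqf
  generalize √(ρ x t) = w at hsq hpos
  rw [hsq]
  field_simp
  ring

theorem hasDerivAt_bohm_primitive (hs : IsQHDSolution1D P ρ u T) {x t : ℝ} (ht : t ∈ Set.Icc 0 T)
    (hx : 0 < ρ x t) :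
    HasDerivAt (fun y => pdx (pdx ρ) y t / 2 - pdx ρ y t ^ 2 / (2 * ρ y t))
      (ρ x t * pdx (fun y s => pdx (pdx (sqf ρ)) y s / sqf ρ y s) x t) x := by
  obtain ⟨h1, h2, h3⟩ := hs.hasDerivAt_rho ht x
  have hev : (fun y => pdx (pdx (sqf ρ)) y t / sqf ρ y t) =ᶠ[nhds x]
      fun y => pdx (pdx ρ) y t / (2 * ρ y t) - pdx ρ y t ^ 2 / (4 * ρ y t ^ 2) := by
    filter_upwards [hs.eventually_pos hx] with y hy using hs.bohm_eq ht hy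
  have hd := (h3.fun_div (h1.const_mul 2) (by positivity)).fun_sub
    ((h2.fun_pow 2).fun_div ((h1.fun_pow 2).const_mul 4) (by positivity))
  have he : pdx (fun y s => pdx (pdx (sqf ρ)) y s / sqf ρ y s) x t = _ :=
    hev.deriv_eq.trans hd.deriv
  rw [he]
  refine ((h3.div_const 2).fun_sub
    ((h2.fun_pow 2).fun_div (h1.const_mul 2) (by positivity))).congr_deriv ?_
  field_simp
  ring

theorem hasDerivAt_momentum_time (hs : IsQHDSolution1D P ρ u T) {x : ℝ}
    (hx : x ∈ Set.Icc (0:ℝ) 1) (t : ℝ) :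
    HasDerivAt (fun s => ρ x s * u x s) (pdt ρ x t * u x t + ρ x t * pdt u x t) t :=
  (hs.hasDerivAt_rho_time hx t).mul (hs.hasDerivAt_u_time hx t)

theorem integral_mass_eq (hs : IsQHDSolution1D P ρ u T) {t : ℝ} (ht : t ∈ Set.Icc 0 T) :
    ∫ x in (0:ℝ)..1, x * (1 - x) * pdt ρ x t
      = ∫ x in (0:ℝ)..1, (1 - 2 * x) * (ρ x t * u x t) := by
  have hc1 : Continuous fun x => pdt ρ x t :=
    hs.rho_t_cont.comp (by fun_prop : Continuous fun x => (x, t))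
  have hc2 : Continuous fun x => ρ x t :=
    hs.rho_cont.comp (by fun_prop : Continuous fun x => (x, t))
  have hc3 : Continuous fun x => u x t :=
    hs.u_cont.comp (by fun_prop : Continuous fun x => (x, t))
  have hftc := intervalIntegral.integral_eq_sub_of_hasDerivAt (a := 0) (b := 1)
    (f := fun x => x * (1 - x) * (ρ x t * u x t))
    (f' := fun x => (1 - 2 * x) * (ρ x t * u x t) - x * (1 - x) * pdt ρ x t) ?_
    (Continuous.intervalIntegrable (by fun_prop) _ _)
  · rw [intervalIntegral.integral_sub (Continuous.intervalIntegrable (by fun_prop) _ _)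
      (Continuous.intervalIntegrable (by fun_prop) _ _)] at hftc
    norm_num at hftc
    linarith
  · intro x hx
    rw [Set.uIcc_of_le zero_le_one] at hx
    have hd := (hs.hasDerivAt_rho ht x).1.fun_mul (hs.hasDerivAt_u ht x)
    have hm := hs.mass x hx t ht
    have he : pdx (fun y s => ρ y s * u y s) x t = _ := hd.deriv
    rw [he] at hm
    refine (((hasDerivAt_id' x).fun_mul ((hasDerivAt_id' x).const_sub 1)).fun_mul hd).congr_deriv ?_
    linear_combination (x * (1 - x)) * hm

theorem momentum_balance (hs : IsQHDSolution1D P ρ u T) (hP : ContDiffOn ℝ 1 P (Set.Ici 0))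
    {t : ℝ} (ht : t ∈ Set.Icc 0 T) (h0 : pdx ρ 0 t = 0) (h1 : pdx ρ 1 t = 0) :
    (∫ x in (0:ℝ)..1, (1 - 2 * x) * (pdt ρ x t * u x t + ρ x t * pdt u x t))
      = (ρ 1 t * u 1 t ^ 2 + P (ρ 1 t) - pdx (pdx ρ) 1 t / 2)
        + (ρ 0 t * u 0 t ^ 2 + P (ρ 0 t) - pdx (pdx ρ) 0 t / 2)
        - 2 * ∫ x in (0:ℝ)..1, (ρ x t * u x t ^ 2 + P (ρ x t) + 2 * (pdx (sqf ρ) x t) ^ 2) := by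
  have hline : Continuous fun x : ℝ => (x, t) := by fun_prop
  have hc1 : Continuous fun x => pdt ρ x t := hs.rho_t_cont.comp hline
  have hc2 : Continuous fun x => ρ x t := hs.rho_cont.comp hline
  have hc3 : Continuous fun x => u x t := hs.u_cont.comp hline
  have hc4 : Continuous fun x => pdt u x t := hs.u_t_cont.comp hline
  have hc5 : Continuous fun x => pdx ρ x t := hs.rho_x_cont.comp hline
  have hcP : ContinuousOn (fun x => P (ρ x t)) (Set.Icc 0 1) :=
    hP.continuousOn.comp hc2.continuousOn fun x hx => (hs.pos x hx t ht).le
  have hcw : ContinuousOn (fun x => pdx (sqf ρ) x t ^ 2) (Set.Icc 0 1) := by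
    refine ContinuousOn.congr (f := fun x => pdx ρ x t ^ 2 / (4 * ρ x t)) ?_
      fun x hx => hs.pdx_sqf_sq ht (hs.pos x hx t ht)
    exact (by fun_prop : Continuous fun x => pdx ρ x t ^ 2).continuousOn.div
      (by fun_prop) fun x hx => mul_ne_zero (by norm_num) (hs.pos x hx t ht).ne'
  have hint1 : IntervalIntegrable
      (fun x => (1 - 2 * x) * (pdt ρ x t * u x t + ρ x t * pdt u x t)) volume 0 1 :=
    Continuous.intervalIntegrable (by fun_prop) _ _
  have hint2 : IntervalIntegrable
      (fun x => ρ x t * u x t ^ 2 + P (ρ x t) + 2 * (pdx (sqf ρ) x t) ^ 2) volume 0 1 := by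
    refine ContinuousOn.intervalIntegrable ?_
    rw [Set.uIcc_of_le zero_le_one]
    exact ((hc2.mul (hc3.pow 2)).continuousOn.add hcP).add (hcw.const_mul 2)
  have hftc := intervalIntegral.integral_eq_sub_of_hasDerivAt (a := 0) (b := 1)
    (f := fun x => (1 - 2 * x) * ((pdx (pdx ρ) x t / 2 - pdx ρ x t ^ 2 / (2 * ρ x t))
      - (ρ x t * u x t ^ 2 + P (ρ x t))) + pdx ρ x t)
    (f' := fun x => (1 - 2 * x) * (pdt ρ x t * u x t + ρ x t * pdt u x t)
      + 2 * (ρ x t * u x t ^ 2 + P (ρ x t) + 2 * (pdx (sqf ρ) x t) ^ 2)) ?_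
    (hint1.add (hint2.const_mul 2))
  · rw [intervalIntegral.integral_add hint1 (hint2.const_mul 2),
      intervalIntegral.integral_const_mul] at hftc
    simp only [h0, h1] at hftc
    norm_num at hftc
    linarith
  · intro x hx
    rw [Set.uIcc_of_le zero_le_one] at hx
    have hpos := hs.pos x hx t ht
    obtain ⟨d1, d2, -⟩ := hs.hasDerivAt_rho ht x
    have hPd : DifferentiableAt ℝ P (ρ x t) :=
      (hP.differentiableOn (by norm_num)).differentiableAt (Ici_mem_nhds hpos)
    have hflux : HasDerivAt (fun y => ρ y t * u y t ^ 2 + P (ρ y t))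
        (pdx (fun y s => ρ y s * u y s ^ 2 + P (ρ y s)) x t) x :=
      (((d1.fun_mul ((hs.hasDerivAt_u ht x).fun_pow 2)).fun_add
        (hPd.hasDerivAt.comp x d1)).differentiableAt).hasDerivAt
    have hm := hs.momentum x hx t ht
    have he : pdt (fun y s => ρ y s * u y s) x t = _ := (hs.hasDerivAt_momentum_time hx t).deriv
    rw [he] at hm
    refine (((((hasDerivAt_id' x).const_mul 2).const_sub 1).fun_mul
      ((hs.hasDerivAt_bohm_primitive ht hpos).fun_sub hflux)).fun_add d2).congr_deriv ?_
    rw [hs.pdx_sqf_sq ht hpos, ← hm]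
    field_simp
    ring

theorem hasDerivAt_integral_momentum (hs : IsQHDSolution1D P ρ u T) (t : ℝ) :
    HasDerivAt (fun s => ∫ x in (0:ℝ)..1, (1 - 2 * x) * (ρ x s * u x s))
      (∫ x in (0:ℝ)..1, (1 - 2 * x) * (pdt ρ x t * u x t + ρ x t * pdt u x t)) t := by
  have c1 := hs.rho_cont
  have c2 := hs.u_cont
  have c3 := hs.rho_t_cont
  have c4 := hs.u_t_cont
  exact hasDerivAt_integral_of_continuous
    (f := fun x s => (1 - 2 * x) * (ρ x s * u x s))
    (f' := fun x s => (1 - 2 * x) * (pdt ρ x s * u x s + ρ x s * pdt u x s))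
    (by fun_prop) (by fun_prop)
    (fun x hx s => (hs.hasDerivAt_momentum_time hx s).const_mul _) t

theorem continuous_integral_momentum_deriv (hs : IsQHDSolution1D P ρ u T) :
    Continuous fun t =>
      ∫ x in (0:ℝ)..1, (1 - 2 * x) * (pdt ρ x t * u x t + ρ x t * pdt u x t) := by
  refine intervalIntegral.continuous_parametric_intervalIntegral_of_continuous' ?_ 0 1
  have hsw : Continuous fun p : ℝ × ℝ => (p.2, p.1) := by fun_prop
  have c1 : Continuous fun p : ℝ × ℝ => ρ p.2 p.1 := hs.rho_cont.comp hsw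
  have c2 : Continuous fun p : ℝ × ℝ => u p.2 p.1 := hs.u_cont.comp hsw
  have c3 : Continuous fun p : ℝ × ℝ => pdt ρ p.2 p.1 := hs.rho_t_cont.comp hsw
  have c4 : Continuous fun p : ℝ × ℝ => pdt u p.2 p.1 := hs.u_t_cont.comp hsw
  exact (continuous_const.sub (continuous_const.mul continuous_snd)).mul
    ((c3.mul c2).add (c1.mul c4))

theorem continuousOn_boundary (hs : IsQHDSolution1D P ρ u T) {g : ℝ → ℝ}
    (hg : ContinuousOn g (Set.Ioi 0)) {x : ℝ} (hx : x ∈ Set.Icc (0:ℝ) 1) :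
    ContinuousOn (fun s => ρ x s * u x s ^ 2 + g (ρ x s) - pdx (pdx ρ) x s / 2)
      (Set.Icc 0 T) := by
  have hline : Continuous fun s : ℝ => (x, s) := by fun_prop
  have c1 : Continuous fun s => ρ x s := hs.rho_cont.comp hline
  have c2 : Continuous fun s => u x s := hs.u_cont.comp hline
  have c3 : Continuous fun s => pdx (pdx ρ) x s := hs.rho_xx_cont.comp hline
  have c4 : ContinuousOn (fun s => g (ρ x s)) (Set.Icc 0 T) :=
    hg.comp c1.continuousOn fun s hs' => hs.pos x hx s hs'
  exact ((c1.mul (c2.pow 2)).continuousOn.add c4).sub (c3.div_const 2).continuousOn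

/-- At a point where `ρ_x = 0`, the momentum flux is dominated by `ρ (K + u² / 2)`. -/
theorem integral_boundary_le (hs : IsQHDSolution1D P ρ u T) {h : ℝ → ℝ}
    (hP : ContDiffOn ℝ 1 P (Set.Ici 0)) (hh : ContDiffOn ℝ 1 h (Set.Ioi 0))
    (hPh : ∀ r > (0:ℝ), P r / r ≤ h r) {K : ℝ → ℝ → ℝ}
    (hK : ∀ x t : ℝ, K x t = u x t ^ 2 / 2 + h (ρ x t) - pdx (pdx (sqf ρ)) x t / sqf ρ x t)
    {x : ℝ} (hx : x ∈ Set.Icc (0:ℝ) 1) (hN : ∀ t ∈ Set.Icc (0:ℝ) T, pdx ρ x t = 0)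
    {t : ℝ} (ht : t ∈ Set.Icc 0 T) :
    ∫ s in (0:ℝ)..t, (ρ x s * u x s ^ 2 + P (ρ x s) - pdx (pdx ρ) x s / 2)
      ≤ ∫ s in (0:ℝ)..t, ρ x s * (K x s + u x s ^ 2 / 2) := by
  have hsub : Set.Icc 0 t ⊆ Set.Icc 0 T := Set.Icc_subset_Icc_right ht.2
  have heq : ∀ s ∈ Set.Icc 0 T, ρ x s * (K x s + u x s ^ 2 / 2)
      = ρ x s * u x s ^ 2 + ρ x s * h (ρ x s) - pdx (pdx ρ) x s / 2 := by
    intro s hs'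
    have hpos := hs.pos x hx s hs'
    rw [hK, hs.bohm_eq hs' hpos, hN s hs']
    field_simp
    ring
  refine intervalIntegral.integral_mono_on ht.1 ?_ ?_ ?_
  · refine ContinuousOn.intervalIntegrable ?_
    rw [Set.uIcc_of_le ht.1]
    exact (hs.continuousOn_boundary (hP.continuousOn.mono Set.Ioi_subset_Ici_self) hx).mono hsub
  · refine ContinuousOn.intervalIntegrable ?_
    rw [Set.uIcc_of_le ht.1]
    exact ((hs.continuousOn_boundary (g := fun r => r * h r)
      (continuousOn_id.mul hh.continuousOn) hx).congr heq).mono hsub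
  · intro s hs'
    have hpos := hs.pos x hx s (hsub hs')
    have hle := (div_le_iff₀ hpos).1 (hPh _ hpos)
    rw [heq s (hsub hs')]
    linarith

end IsQHDSolution1D

/-- Differential inequality for the observable `I(t) = ∫₀¹ x(1−x)ρ dx`: under the subcritical
pressure condition `P(ρ)/ρ ≤ h(ρ)`, the derivative of `I` is bounded by
`M₀ − 2∫₀ᵗ∫₀¹(ρu² + P(ρ) + 2((√ρ)_x)²) + ∫₀ᵗ ρ(K + ½u²)(1,s) ds + ∫₀ᵗ ρ(K + ½u²)(0,s) ds`. -/
theorem qhd1d_observable_inequality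
    (P h : ℝ → ℝ) (hP : ContDiffOn ℝ 1 P (Set.Ici 0))
    (hh : ContDiffOn ℝ 1 h (Set.Ioi 0))
    (hh' : ∀ r > (0:ℝ), deriv h r = deriv P r / r)
    (hPh : ∀ r > (0:ℝ), P r / r ≤ h r)
    (T : ℝ) (hT : 0 ≤ T) (ρ u : ℝ → ℝ → ℝ) (ρI uI : ℝ → ℝ)
    (hsol : IsQHDSolution1D P ρ u T)
    (hρI : ∀ x ∈ Set.Icc (0:ℝ) 1, ρ x 0 = ρI x)
    (huI : ∀ x ∈ Set.Icc (0:ℝ) 1, u x 0 = uI x)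
    (hNeumann : ∀ t ∈ Set.Icc (0:ℝ) T, pdx ρ 0 t = 0 ∧ pdx ρ 1 t = 0)
    (I : ℝ → ℝ) (hI : ∀ t : ℝ, I t = ∫ x in (0:ℝ)..1, x * (1 - x) * ρ x t)
    (M₀ : ℝ) (hM₀ : M₀ = ∫ x in (0:ℝ)..1, (1 - 2 * x) * ρI x * uI x)
    (K : ℝ → ℝ → ℝ)
    (hK : ∀ x t : ℝ, K x t = u x t ^ 2 / 2 + h (ρ x t) - pdx (pdx (sqf ρ)) x t / sqf ρ x t) :
    ∀ t ∈ Set.Icc (0:ℝ) T, ∃ d : ℝ,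
      HasDerivWithinAt I d (Set.Icc 0 T) t ∧
      d ≤ M₀
          - 2 * (∫ s in (0:ℝ)..t, ∫ x in (0:ℝ)..1,
              (ρ x s * u x s ^ 2 + P (ρ x s) + 2 * (pdx (sqf ρ) x s) ^ 2))
          + (∫ s in (0:ℝ)..t, ρ 1 s * (K 1 s + u 1 s ^ 2 / 2))
          + ∫ s in (0:ℝ)..t, ρ 0 s * (K 0 s + u 0 s ^ 2 / 2) := by
  intro t ht
  have hsub : Set.Icc 0 t ⊆ Set.Icc 0 T := Set.Icc_subset_Icc_right ht.2
  have h0mem : (0:ℝ) ∈ Set.Icc (0:ℝ) 1 := by simp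
  have h1mem : (1:ℝ) ∈ Set.Icc (0:ℝ) 1 := by simp
  refine ⟨∫ x in (0:ℝ)..1, (1 - 2 * x) * (ρ x t * u x t), ?_, ?_⟩
  · rw [← hsol.integral_mass_eq ht, funext hI]
    have c1 := hsol.rho_cont
    have c2 := hsol.rho_t_cont
    exact (hasDerivAt_integral_of_continuous (f := fun x s => x * (1 - x) * ρ x s)
      (f' := fun x s => x * (1 - x) * pdt ρ x s) (by fun_prop) (by fun_prop)
      (fun x hx s => (hsol.hasDerivAt_rho_time hx s).const_mul _) t).hasDerivWithinAt
  · have hM : M₀ = ∫ x in (0:ℝ)..1, (1 - 2 * x) * (ρ x 0 * u x 0) := by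
      rw [hM₀]
      refine intervalIntegral.integral_congr fun x hx => ?_
      rw [Set.uIcc_of_le zero_le_one] at hx
      simp only [hρI x hx, huI x hx, mul_assoc]
    have hftc := intervalIntegral.integral_eq_sub_of_hasDerivAt (a := 0) (b := t)
      (fun s _ => hsol.hasDerivAt_integral_momentum s)
      (hsol.continuous_integral_momentum_deriv.intervalIntegrable _ _)
    have hbd : ∀ x ∈ Set.Icc (0:ℝ) 1, IntervalIntegrable
        (fun s => ρ x s * u x s ^ 2 + P (ρ x s) - pdx (pdx ρ) x s / 2) volume 0 t := by
      intro x hx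
      refine ContinuousOn.intervalIntegrable ?_
      rw [Set.uIcc_of_le ht.1]
      exact (hsol.continuousOn_boundary
        (hP.continuousOn.mono Set.Ioi_subset_Ici_self) hx).mono hsub
    have hbal : Set.EqOn
        (fun s => 2 * ∫ x in (0:ℝ)..1,
          (ρ x s * u x s ^ 2 + P (ρ x s) + 2 * (pdx (sqf ρ) x s) ^ 2))
        (fun s => (ρ 1 s * u 1 s ^ 2 + P (ρ 1 s) - pdx (pdx ρ) 1 s / 2)
          + (ρ 0 s * u 0 s ^ 2 + P (ρ 0 s) - pdx (pdx ρ) 0 s / 2)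
          - ∫ x in (0:ℝ)..1, (1 - 2 * x) * (pdt ρ x s * u x s + ρ x s * pdt u x s))
        (Set.uIcc 0 t) := by
      intro s hs
      rw [Set.uIcc_of_le ht.1] at hs
      have hN := hNeumann s (hsub hs)
      have hb := hsol.momentum_balance hP (hsub hs) hN.1 hN.2
      simp only
      linarith
    have hint := intervalIntegral.integral_congr (μ := volume) hbal
    rw [intervalIntegral.integral_const_mul, intervalIntegral.integral_sub
      ((hbd 1 h1mem).add (hbd 0 h0mem))
      (hsol.continuous_integral_momentum_deriv.intervalIntegrable _ _),
      intervalIntegral.integral_add (hbd 1 h1mem) (hbd 0 h0mem), hftc] at hint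
    have hb1 := hsol.integral_boundary_le hP hh hPh hK h1mem (fun s hs => (hNeumann s hs).2) ht
    have hb0 := hsol.integral_boundary_le hP hh hPh hK h0mem (fun s hs => (hNeumann s hs).1) ht
    linarith
end
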